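/- arXiv:2007.10432 — 3 statements merged into one kernel-verified Lean document; each statement's English description precedes it below -/
import Mathlib

section
/- In the M₃-filtered 2×T ARUM with strict one-to-one targeting (T ≥ 3): (i) the five D-response-group probabilities are point-identified: P(A₀ᴰ) = Pᴰ(0|1), P(A₁ᴰ) = Pᴰ(1|0), P(A₂ᴰ) = Pᴰ(2|1), P(C₀₁ᴰ) = Pᴰ(0|0) − Pᴰ(0|1), and P(C₂₁ᴰ) = Pᴰ(2|0) − Pᴰ(2|1), with the testable implications Pᴰ(0|0) ≥ Pᴰ(0|1) and Pᴰ(2|0) ≥ Pᴰ(2|1); (ii) letting 𝒞 := C₀₁ᴰ ∪ C₂₁ᴰ (assumed of positive probability, with P(C_{t1}) > 0 for all t ≠ 1), the Wald estimand satisfies (E[Y | Z = 1] − E[Y | Z = 0]) / (Pᴰ(1|1) − Pᴰ(1|0)) = E[Y(1) | 𝒞] − α₀ · E[Y(0) | C_{01}] − (1 − α₀) · Σ_{t ≥ 2} β_t · E[Y(t) | C_{t1}], where α₀ := P(C₀₁ᴰ) / P(𝒞) = (Pᴰ(0|0) − Pᴰ(0|1)) / (Pᴰ(1|1) − Pᴰ(1|0))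 and β_t := P(C_{t1}) / P(C₂₁ᴰ) are positive weights summing to 1. -/
open MeasureTheory ProbabilityTheory

noncomputable section

variable {Ω : Type*} [MeasurableSpace Ω]

/-- Probability of an event, as a real number. -/
def prr (P : Measure Ω) (A : Set Ω) : ℝ := (P A).toReal

/-- Conditional expectation `E[X | C]` of `X` given the event `C`. -/
def cexp (P : Measure Ω) (X : Ω → ℝ) (C : Set Ω) : ℝ :=
  (∫ ω in C, X ω ∂P) / prr P C

/-- Conditional probability `P(D = d | Z = z)` (generalized propensity score). -/
def pscore {𝒟 𝒵 : Type*} (P : Measure Ω) (D : Ω → 𝒟) (Z : Ω → 𝒵) (d : 𝒟) (z : 𝒵) : ℝ :=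
  prr P ({ω | D ω = d} ∩ {ω | Z ω = z}) / prr P {ω | Z ω = z}

/-- Conditional average outcome `Ē_z(d) = E[Y·1(D = d) | Z = z]`. -/
def ebar {𝒟 𝒵 : Type*} (P : Measure Ω) (D : Ω → 𝒟) (Z : Ω → 𝒵) (Yobs : Ω → ℝ)
    (z : 𝒵) (d : 𝒟) : ℝ :=
  (∫ ω in {ω | D ω = d} ∩ {ω | Z ω = z}, Yobs ω ∂P) / prr P {ω | Z ω = z}

/-- Conditional mean outcome `E[Y | Z = z]`. -/
def ecz {𝒵 : Type*} (P : Measure Ω) (Z : Ω → 𝒵) (Yobs : Ω → ℝ) (z : 𝒵) : ℝ :=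
  (∫ ω in {ω | Z ω = z}, Yobs ω ∂P) / prr P {ω | Z ω = z}

/-- The `M₃` filter: `M₃(0) = 0`, `M₃(1) = 1`, `M₃(t) = 2` for `t ≥ 2`. -/
def m3 {k : ℕ} (t : Fin (k + 3)) : ℕ := if t = 0 then 0 else if t = 1 then 1 else 2

theorem m3_eq_zero {k : ℕ} {t : Fin (k + 3)} : m3 t = 0 ↔ t = 0 := by
  unfold m3; split_ifs <;> simp_all

theorem m3_eq_one {k : ℕ} {t : Fin (k + 3)} : m3 t = 1 ↔ t = 1 := by
  unfold m3; split_ifs <;> simp_all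

theorem m3_eq_two {k : ℕ} {t : Fin (k + 3)} : m3 t = 2 ↔ 2 ≤ (t : ℕ) := by
  unfold m3
  split_ifs with h0 h1
  · simp [h0]
  · simp [h1]
  · have h0' : (t : ℕ) ≠ 0 := fun h => h0 (Fin.ext h)
    have h1' : (t : ℕ) ≠ 1 := fun h => h1 (Fin.ext (by simp [h]))
    simp only [true_iff]
    omega

/-- Integrating a function of `W` over a level set of an independent variable `Z`. -/
theorem setIntegral_level_of_indepFun {𝒵 𝒲 : Type*} [MeasurableSpace 𝒵]
    [MeasurableSingletonClass 𝒵] [MeasurableSpace 𝒲] {P : Measure Ω} {Z : Ω → 𝒵} {W : Ω → 𝒲}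
    (h : IndepFun Z W P) (hZ : Measurable Z) (hW : Measurable W) {φ : 𝒲 → ℝ}
    (hφ : Measurable φ) (z : 𝒵) :
    ∫ ω in {ω | Z ω = z}, φ (W ω) ∂P = prr P {ω | Z ω = z} * ∫ ω, φ (W ω) ∂P := by
  have hs : MeasurableSet {ω | Z ω = z} := hZ (measurableSet_singleton z)
  have hψ : Measurable (({z} : Set 𝒵).indicator (fun _ => (1 : ℝ))) :=
    measurable_const.indicator (measurableSet_singleton z)
  have key := (h.comp hψ hφ).integral_fun_mul_eq_mul_integral
    (hψ.comp hZ).aestronglyMeasurable (hφ.comp hW).aestronglyMeasurable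
  have h1 : ∫ ω, (({z} : Set 𝒵).indicator (fun _ => (1 : ℝ)) ∘ Z) ω ∂P
      = prr P {ω | Z ω = z} := by
    have : (({z} : Set 𝒵).indicator (fun _ => (1 : ℝ)) ∘ Z)
        = ({ω | Z ω = z}).indicator 1 := by
      ext ω
      by_cases hω : Z ω = z <;> simp [hω]
    rw [this, integral_indicator_one hs]; rfl
  rw [h1] at key
  rw [← integral_indicator hs]
  refine Eq.trans (integral_congr_ae (.of_forall fun ω => ?_)) key
  by_cases hω : Z ω = z <;> simp [hω]

/-- Under independence, `P(f(T(Z)) = d | Z = z) = P(f(T(z)) = d)`. -/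
theorem pscore_eq_of_indepFun {𝒟 𝒵 𝒯 𝒲 : Type*} [MeasurableSpace 𝒵]
    [MeasurableSingletonClass 𝒵] [MeasurableSpace 𝒯] [DiscreteMeasurableSpace 𝒯]
    [MeasurableSpace 𝒲] {P : Measure Ω} [IsFiniteMeasure P] {Z : Ω → 𝒵} {W : Ω → 𝒲}
    (h : IndepFun Z W P) {z : 𝒵} (hz : 0 < P {ω | Z ω = z}) {T : 𝒵 → Ω → 𝒯} {τ : 𝒲 → 𝒯}
    (hτ : Measurable τ) (hT : ∀ ω, T z ω = τ (W ω)) (f : 𝒯 → 𝒟) (d : 𝒟) :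
    pscore P (fun ω => f (T (Z ω) ω)) Z d z = prr P {ω | f (T z ω) = d} := by
  have hset : {ω | f (T (Z ω) ω) = d} ∩ {ω | Z ω = z}
      = Z ⁻¹' {z} ∩ W ⁻¹' (τ ⁻¹' (f ⁻¹' {d})) := by
    ext ω
    simp only [Set.mem_inter_iff, Set.mem_ofPred_eq, Set.mem_preimage, Set.mem_singleton_iff,
      ← hT]
    constructor
    · rintro ⟨h1, h2⟩; subst h2; exact ⟨rfl, h1⟩
    · rintro ⟨h1, h2⟩; subst h1; exact ⟨h2, rfl⟩
  have hset' : {ω | f (T z ω) = d} = W ⁻¹' (τ ⁻¹' (f ⁻¹' {d})) := by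
    ext ω; simp [hT]
  have hz' : (P (Z ⁻¹' {z})).toReal ≠ 0 := (ENNReal.toReal_pos hz.ne' (measure_ne_top _ _)).ne'
  unfold pscore prr
  rw [hset, hset', h.measure_inter_preimage_eq_mul _ _ (measurableSet_singleton z)
    (hτ (MeasurableSet.of_discrete)), ENNReal.toReal_mul]
  exact mul_div_cancel_left₀ _ hz'

/-- Strict one-to-one targeting: an instrument change moves units only into treatment `1`. -/
theorem eq_or_eq_one_of_targeting {𝒯 : Type*} [Zero 𝒯] [One 𝒯] {U : Fin 2 → 𝒯 → ℝ} {v : 𝒯 → ℝ}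
    {T : Fin 2 → 𝒯} (hmax : ∀ z t, t ≠ T z → U z t + v t < U z (T z) + v (T z))
    (hΔ1 : U 0 1 - U 0 0 < U 1 1 - U 1 0)
    (hΔt : ∀ t : 𝒯, t ≠ 1 → U 1 t - U 1 0 = U 0 t - U 0 0) :
    T 0 = T 1 ∨ T 0 ≠ 1 ∧ T 1 = 1 := by
  by_cases h : T 0 = T 1
  · exact .inl h
  have h0 := hmax 0 (T 1) (Ne.symm h)
  have h1 := hmax 1 (T 0) h
  by_cases hb : T 1 = 1
  · exact .inr ⟨fun ha => h (ha.trans hb.symm), hb⟩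
  have hb' := hΔt _ hb
  by_cases ha : T 0 = 1
  · rw [ha] at h0 h1
    linarith
  · have ha' := hΔt _ ha
    linarith

theorem prr_congr {P : Measure Ω} {A B : Set Ω} (h : ∀ᵐ ω ∂P, ω ∈ A ↔ ω ∈ B) :
    prr P A = prr P B := by
  unfold prr
  rw [measure_congr (Filter.eventuallyEq_set.2 h)]

theorem prr_union {P : Measure Ω} [IsFiniteMeasure P] {A B : Set Ω} (hd : Disjoint A B)
    (hB : MeasurableSet B) : prr P (A ∪ B) = prr P A + prr P B :=
  measureReal_union hd hB

/-- Proposition (identification in the `M₃`-filtered 2×T model, `T ≥ 3`). -/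
theorem statement17
    (P : Measure Ω) [IsProbabilityMeasure P] (n : ℕ)
    (T : Fin 2 → Ω → Fin (n + 3)) (Z : Ω → Fin 2) (Y : Fin (n + 3) → Ω → ℝ)
    (U : Fin 2 → Fin (n + 3) → ℝ) (u : Fin (n + 3) → Ω → ℝ)
    (hTmeas : ∀ z, Measurable (T z)) (hZmeas : Measurable Z)
    (hYmeas : ∀ t, Measurable (Y t)) (hYint : ∀ t, Integrable (Y t) P)
    (humeas : ∀ t, Measurable (u t))
    (hZpos : ∀ z, 0 < P {ω | Z ω = z})
    (hindep : IndepFun Z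
      (fun ω => ((fun z => T z ω), (fun t => Y t ω), (fun t => u t ω))) P)
    (hmax : ∀ᵐ ω ∂P, ∀ z t, t ≠ T z ω →
      U z t + u t ω < U z (T z ω) + u (T z ω) ω)
    (hΔ1 : U 0 1 - U 0 0 < U 1 1 - U 1 0)
    (hΔt : ∀ t : Fin (n + 3), t ≠ 1 → U 1 t - U 1 0 = U 0 t - U 0 0)
    -- positive probabilities for part (ii)
    (hC : 0 < P ({ω | T 0 ω = 0 ∧ T 1 ω = 1}
        ∪ ⋃ t ∈ {t : Fin (n + 3) | 2 ≤ (t : ℕ)}, {ω | T 0 ω = t ∧ T 1 ω = 1}))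
    (hC21D : 0 < P (⋃ t ∈ {t : Fin (n + 3) | 2 ≤ (t : ℕ)}, {ω | T 0 ω = t ∧ T 1 ω = 1}))
    (hCt : ∀ t : Fin (n + 3), t ≠ 1 → 0 < P {ω | T 0 ω = t ∧ T 1 ω = 1}) :
    -- (i) the five D-response-group probabilities are point-identified
    prr P {ω | T 0 ω = 0 ∧ T 1 ω = 0} = pscore P (fun ω => m3 (T (Z ω) ω)) Z 0 1
    ∧ prr P {ω | T 0 ω = 1 ∧ T 1 ω = 1} = pscore P (fun ω => m3 (T (Z ω) ω)) Z 1 0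
    ∧ prr P (⋃ t ∈ {t : Fin (n + 3) | 2 ≤ (t : ℕ)}, {ω | T 0 ω = t ∧ T 1 ω = t})
        = pscore P (fun ω => m3 (T (Z ω) ω)) Z 2 1
    ∧ prr P {ω | T 0 ω = 0 ∧ T 1 ω = 1}
        = pscore P (fun ω => m3 (T (Z ω) ω)) Z 0 0
          - pscore P (fun ω => m3 (T (Z ω) ω)) Z 0 1
    ∧ prr P (⋃ t ∈ {t : Fin (n + 3) | 2 ≤ (t : ℕ)}, {ω | T 0 ω = t ∧ T 1 ω = 1})
        = pscore P (fun ω => m3 (T (Z ω) ω)) Z 2 0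
          - pscore P (fun ω => m3 (T (Z ω) ω)) Z 2 1
    -- testable implications
    ∧ pscore P (fun ω => m3 (T (Z ω) ω)) Z 0 1 ≤ pscore P (fun ω => m3 (T (Z ω) ω)) Z 0 0
    ∧ pscore P (fun ω => m3 (T (Z ω) ω)) Z 2 1 ≤ pscore P (fun ω => m3 (T (Z ω) ω)) Z 2 0
    -- (ii) the Wald estimand
    ∧ (ecz P Z (fun ω => Y (T (Z ω) ω) ω) 1 - ecz P Z (fun ω => Y (T (Z ω) ω) ω) 0)
        / (pscore P (fun ω => m3 (T (Z ω) ω)) Z 1 1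
            - pscore P (fun ω => m3 (T (Z ω) ω)) Z 1 0)
      = cexp P (Y 1) ({ω | T 0 ω = 0 ∧ T 1 ω = 1}
            ∪ ⋃ t ∈ {t : Fin (n + 3) | 2 ≤ (t : ℕ)}, {ω | T 0 ω = t ∧ T 1 ω = 1})
        - (prr P {ω | T 0 ω = 0 ∧ T 1 ω = 1}
              / prr P ({ω | T 0 ω = 0 ∧ T 1 ω = 1}
                ∪ ⋃ t ∈ {t : Fin (n + 3) | 2 ≤ (t : ℕ)}, {ω | T 0 ω = t ∧ T 1 ω = 1}))
            * cexp P (Y 0) {ω | T 0 ω = 0 ∧ T 1 ω = 1}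
        - (1 - prr P {ω | T 0 ω = 0 ∧ T 1 ω = 1}
              / prr P ({ω | T 0 ω = 0 ∧ T 1 ω = 1}
                ∪ ⋃ t ∈ {t : Fin (n + 3) | 2 ≤ (t : ℕ)}, {ω | T 0 ω = t ∧ T 1 ω = 1}))
            * ∑ t ∈ Finset.univ.filter (fun t : Fin (n + 3) => 2 ≤ (t : ℕ)),
                (prr P {ω | T 0 ω = t ∧ T 1 ω = 1}
                    / prr P (⋃ t' ∈ {t' : Fin (n + 3) | 2 ≤ (t' : ℕ)},
                        {ω | T 0 ω = t' ∧ T 1 ω = 1}))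
                  * cexp P (Y t) {ω | T 0 ω = t ∧ T 1 ω = 1}
    -- α₀ is identified
    ∧ prr P {ω | T 0 ω = 0 ∧ T 1 ω = 1}
          / prr P ({ω | T 0 ω = 0 ∧ T 1 ω = 1}
            ∪ ⋃ t ∈ {t : Fin (n + 3) | 2 ≤ (t : ℕ)}, {ω | T 0 ω = t ∧ T 1 ω = 1})
        = (pscore P (fun ω => m3 (T (Z ω) ω)) Z 0 0
            - pscore P (fun ω => m3 (T (Z ω) ω)) Z 0 1)
          / (pscore P (fun ω => m3 (T (Z ω) ω)) Z 1 1
            - pscore P (fun ω => m3 (T (Z ω) ω)) Z 1 0)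
    -- the β weights are positive and sum to one
    ∧ (∀ t : Fin (n + 3), 2 ≤ (t : ℕ) →
        0 < prr P {ω | T 0 ω = t ∧ T 1 ω = 1}
            / prr P (⋃ t' ∈ {t' : Fin (n + 3) | 2 ≤ (t' : ℕ)}, {ω | T 0 ω = t' ∧ T 1 ω = 1}))
    ∧ ∑ t ∈ Finset.univ.filter (fun t : Fin (n + 3) => 2 ≤ (t : ℕ)),
        prr P {ω | T 0 ω = t ∧ T 1 ω = 1}
          / prr P (⋃ t' ∈ {t' : Fin (n + 3) | 2 ≤ (t' : ℕ)}, {ω | T 0 ω = t' ∧ T 1 ω = 1})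
        = 1 := by
  classical
  have h01 : (0 : Fin (n + 3)) ≠ 1 := by simp
  have hW : Measurable
      (fun ω => ((fun z => T z ω), (fun t => Y t ω), (fun t => u t ω))) := by
    fun_prop
  have hps : ∀ d z, pscore P (fun ω => m3 (T (Z ω) ω)) Z d z = prr P {ω | m3 (T z ω) = d} :=
    fun d z => pscore_eq_of_indepFun hindep (hZpos z)
      (τ := fun w => w.1 z) (by fun_prop) (fun _ => rfl) m3 d
  have hecz : ∀ z, ecz P Z (fun ω => Y (T (Z ω) ω) ω) z = ∫ ω, Y (T z ω) ω ∂P := by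
    intro z
    have hz' : prr P {ω | Z ω = z} ≠ 0 :=
      (ENNReal.toReal_pos (hZpos z).ne' (measure_ne_top _ _)).ne'
    have hφ : Measurable (fun w : (Fin 2 → Fin (n + 3)) × (Fin (n + 3) → ℝ) ×
        (Fin (n + 3) → ℝ) => w.2.1 (w.1 z)) := by
      have : (fun w : (Fin 2 → Fin (n + 3)) × (Fin (n + 3) → ℝ) ×
          (Fin (n + 3) → ℝ) => w.2.1 (w.1 z))
          = fun w => ∑ s, if w.1 z = s then w.2.1 s else 0 := by
        ext w; simp
      rw [this]
      refine Finset.measurable_sum _ fun s _ => Measurable.ite ?_ (by fun_prop) measurable_const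
      have hz : Measurable (fun w : (Fin 2 → Fin (n + 3)) × (Fin (n + 3) → ℝ) ×
          (Fin (n + 3) → ℝ) => w.1 z) := by fun_prop
      exact hz (measurableSet_singleton s)
    unfold ecz
    rw [← mul_div_cancel_left₀ (∫ ω, Y (T z ω) ω ∂P) hz',
      ← setIntegral_level_of_indepFun hindep hZmeas hW hφ z]
    congr 1
    refine setIntegral_congr_fun (hZmeas (measurableSet_singleton z)) fun ω hω => ?_
    have hω' : Z ω = z := hω
    simp only [hω']
  have hae : ∀ᵐ ω ∂P, T 0 ω = T 1 ω ∨ T 0 ω ≠ 1 ∧ T 1 ω = 1 := by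
    filter_upwards [hmax] with ω hω
    exact eq_or_eq_one_of_targeting (T := fun z => T z ω) (v := fun t => u t ω) hω hΔ1 hΔt
  have hTs : ∀ z s, MeasurableSet {ω | T z ω = s} :=
    fun z s => hTmeas z (measurableSet_singleton s)
  set C : Fin (n + 3) → Set Ω := fun t => {ω | T 0 ω = t ∧ T 1 ω = 1} with hCdef
  have hCm : ∀ t, MeasurableSet (C t) := fun t => (hTs 0 t).inter (hTs 1 1)
  have hCdisj : Pairwise (Function.onFun Disjoint C) := by
    intro s t hst
    exact Set.disjoint_left.2 fun ω h1 h2 => hst (h1.1.symm.trans h2.1)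
  set S : Finset (Fin (n + 3)) := Finset.univ.filter (fun t => 2 ≤ (t : ℕ)) with hS
  have hbu : ∀ t : Fin (n + 3), t ∈ S ↔ 2 ≤ (t : ℕ) := by simp [hS]
  have hSne1 : (1 : Fin (n + 3)) ∉ S := by simp [hS]
  set B : Set Ω := ⋃ t ∈ {t : Fin (n + 3) | 2 ≤ (t : ℕ)}, {ω | T 0 ω = t ∧ T 1 ω = 1} with hB
  have hBS : B = ⋃ t ∈ S, C t := by
    ext ω; simp [hB, hCdef, hS]
  have hBmem : ∀ ω, ω ∈ B ↔ 2 ≤ (T 0 ω : ℕ) ∧ T 1 ω = 1 := by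
    intro ω; simp [hB]
  have hBm : MeasurableSet B := by
    rw [hBS]; exact S.measurableSet_biUnion fun t _ => hCm t
  set A : Set Ω := ⋃ t ∈ {t : Fin (n + 3) | 2 ≤ (t : ℕ)}, {ω | T 0 ω = t ∧ T 1 ω = t} with hA
  have hAmem : ∀ ω, ω ∈ A ↔ 2 ≤ (T 0 ω : ℕ) ∧ T 1 ω = T 0 ω := by
    intro ω; simp [hA]
  have htri : ∀ t : Fin (n + 3), t = 0 ∨ t = 1 ∨ 2 ≤ (t : ℕ) := by
    intro t
    by_cases h0 : m3 t = 0
    · exact .inl (m3_eq_zero.1 h0)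
    by_cases h1 : m3 t = 1
    · exact .inr (.inl (m3_eq_one.1 h1))
    · refine .inr (.inr (m3_eq_two.1 ?_))
      unfold m3 at *
      split_ifs at * <;> simp_all
  have hone : ¬ 2 ≤ ((1 : Fin (n + 3)) : ℕ) := by simp
  have hzero : ¬ 2 ≤ ((0 : Fin (n + 3)) : ℕ) := by simp
  have hBC0 : Disjoint (C 0) B := Set.disjoint_left.2 fun ω h1 h2 => by
    have := ((hBmem ω).1 h2).1
    rw [h1.1] at this; exact hzero this
  have e01 : prr P {ω | m3 (T 1 ω) = 0} = prr P {ω | T 0 ω = 0 ∧ T 1 ω = 0} := by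
    refine prr_congr ?_
    filter_upwards [hae] with ω hω
    simp only [m3_eq_zero]
    grind
  have e10 : prr P {ω | m3 (T 0 ω) = 1} = prr P {ω | T 0 ω = 1 ∧ T 1 ω = 1} := by
    refine prr_congr ?_
    filter_upwards [hae] with ω hω
    simp only [m3_eq_one]
    grind
  have e21 : prr P {ω | m3 (T 1 ω) = 2} = prr P A := by
    refine prr_congr ?_
    filter_upwards [hae] with ω hω
    simp only [m3_eq_two, hAmem]
    grind
  have e00 : prr P {ω | m3 (T 0 ω) = 0}
      = prr P {ω | T 0 ω = 0 ∧ T 1 ω = 0} + prr P (C 0) := by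
    rw [← prr_union (Set.disjoint_left.2 fun ω h1 h2 => h01 (h1.2.symm.trans h2.2)) (hCm 0)]
    refine prr_congr ?_
    filter_upwards [hae] with ω hω
    simp only [Set.mem_ofPred_eq, m3_eq_zero, Set.mem_union, hCdef]
    grind
  have e20 : prr P {ω | m3 (T 0 ω) = 2} = prr P A + prr P B := by
    have hd : Disjoint A B := Set.disjoint_left.2 fun ω h1 h2 => by
      rw [hAmem] at h1; rw [hBmem] at h2
      rw [← h1.2, h2.2] at h1; exact hone h1.1
    rw [← prr_union hd hBm]
    refine prr_congr ?_
    filter_upwards [hae] with ω hω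
    simp only [m3_eq_two, Set.mem_union, hAmem, hBmem]
    grind
  have e11 : prr P {ω | m3 (T 1 ω) = 1}
      = prr P {ω | T 0 ω = 1 ∧ T 1 ω = 1} + prr P (C 0 ∪ B) := by
    have hd : Disjoint {ω | T 0 ω = 1 ∧ T 1 ω = 1} (C 0 ∪ B) :=
      Set.disjoint_left.2 fun ω h1 h2 => by
        rcases h2 with h2 | h2
        · exact h01 (h2.1.symm.trans h1.1)
        · rw [hBmem, h1.1] at h2; exact hone h2.1
    rw [← prr_union hd ((hCm 0).union hBm)]
    refine prr_congr ?_
    filter_upwards [hae] with ω hω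
    simp only [Set.mem_ofPred_eq, m3_eq_one, Set.mem_union, hBmem, hCdef]
    have := htri (T 0 ω)
    grind
  have hCB : prr P (C 0 ∪ B) = prr P (C 0) + prr P B := prr_union hBC0 hBm
  have hBsum : prr P B = ∑ t ∈ S, prr P (C t) := by
    rw [hBS]
    exact measureReal_biUnion_finset (fun s _ t _ hst => hCdisj hst) fun t _ => hCm t
  have hBpos : 0 < prr P B := ENNReal.toReal_pos hC21D.ne' (measure_ne_top _ _)
  have hCpos : ∀ t, t ≠ 1 → 0 < prr P (C t) := fun t ht =>
    ENNReal.toReal_pos (hCt t ht).ne' (measure_ne_top _ _)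
  have hC0pos := hCpos 0 h01
  have hYT : ∀ z, Integrable (fun ω => Y (T z ω) ω) P := by
    intro z
    have : (fun ω => Y (T z ω) ω) = fun ω => ∑ s, ({ω | T z ω = s}).indicator (Y s) ω := by
      ext ω; simp [Set.indicator_apply]
    rw [this]
    exact integrable_finsetSum _ fun s _ => (hYint s).indicator (hTs z s)
  have hdiff : ∫ ω, Y (T 1 ω) ω ∂P - ∫ ω, Y (T 0 ω) ω ∂P
      = ∫ ω in C 0 ∪ B, Y 1 ω ∂P - ∫ ω in C 0, Y 0 ω ∂P
        - ∑ t ∈ S, ∫ ω in C t, Y t ω ∂P := by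
    have hi1 := (hYint 1).indicator ((hCm 0).union hBm)
    have hi0 := (hYint 0).indicator (hCm 0)
    have hit : ∀ t ∈ S, Integrable ((C t).indicator (Y t)) P :=
      fun t _ => (hYint t).indicator (hCm t)
    rw [← integral_sub (hYT 1) (hYT 0), ← integral_indicator ((hCm 0).union hBm),
      ← integral_indicator (hCm 0),
      Finset.sum_congr rfl fun t _ => (integral_indicator (hCm t)).symm,
      ← integral_finsetSum _ hit, ← integral_sub' hi1 hi0,
      ← integral_sub (hi1.sub hi0) (integrable_finsetSum _ hit)]
    refine integral_congr_ae ?_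
    filter_upwards [hae] with ω hω
    have hsum : ∑ t ∈ S, (C t).indicator (Y t) ω
        = if ω ∈ B then Y (T 0 ω) ω else 0 := by
      have : ∀ t ∈ S, (C t).indicator (Y t) ω
          = if T 0 ω = t then (if T 1 ω = 1 then Y t ω else 0) else 0 := by
        intro t _
        simp only [Set.indicator_apply, hCdef, Set.mem_ofPred_eq, ite_and]
      rw [Finset.sum_congr rfl this, Finset.sum_ite_eq]
      simp only [hbu, hBmem, ite_and]
    have hC0 : ω ∈ C 0 ↔ T 0 ω = 0 ∧ T 1 ω = 1 := Iff.rfl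
    simp only [Pi.sub_apply, hsum]
    simp only [Set.indicator_apply, Set.mem_union, hBmem, hC0]
    rcases htri (T 0 ω) with h | h | h
    · rcases hω with h' | h'
      · simp [← h', h]
      · simp [h, h'.2]
    · have h' : T 1 ω = 1 := by grind
      simp [h, h']
    · have h0 : T 0 ω ≠ 0 := fun h0 => hzero (h0 ▸ h)
      by_cases h' : T 1 ω = 1
      · simp [h, h0, h']
      · have h'' : T 0 ω = T 1 ω := hω.resolve_right fun h => h' h.2
        simp [h', h'']
  simp only [hps, hecz, hdiff]
  rw [e01, e10, e21, e00, e20, e11, show {ω | T 0 ω = 0 ∧ T 1 ω = 1} = C 0 from rfl, hCB]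
  refine ⟨rfl, rfl, rfl, by ring, by ring, by linarith, by linarith, ?_, ?_, ?_, ?_⟩
  · have hterm : ∀ t ∈ S, prr P (C t) / prr P B * cexp P (Y t) (C t)
        = (∫ ω in C t, Y t ω ∂P) / prr P B := by
      intro t ht
      have := (hCpos t fun h => hSne1 (h ▸ ht)).ne'
      unfold cexp
      field_simp
    change _ = cexp P (Y 1) (C 0 ∪ B) - prr P (C 0) / (prr P (C 0) + prr P B) * cexp P (Y 0) (C 0)
      - (1 - prr P (C 0) / (prr P (C 0) + prr P B))
        * ∑ t ∈ S, prr P (C t) / prr P B * cexp P (Y t) (C t)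
    rw [Finset.sum_congr rfl hterm, ← Finset.sum_div, add_sub_cancel_left]
    unfold cexp
    rw [hCB]
    have : prr P (C 0) + prr P B ≠ 0 := by positivity
    field_simp
    ring
  · congr 1 <;> ring
  · intro t ht
    exact div_pos (hCpos t fun h => hone (h ▸ ht)) hBpos
  · change ∑ t ∈ S, prr P (C t) / prr P B = 1
    rw [← Finset.sum_div, ← hBsum, div_self hBpos.ne']
end
end

section
/- In the 3×2-filtered 3×3 ARUM with strict one-to-one targeting: (i) P(A₁ᴰ) = Pᴰ(1|0), and the remaining D-group probabilities satisfy P(Cᴰ_{010}) + P(Cᴰ_{011}) = Pᴰ(0|0) − Pᴰ(0|1), P(Cᴰ_{001}) + P(Cᴰ_{011}) = Pᴰ(0|0) − Pᴰ(0|2), and P(Cᴰ_{001}) + P(A₀ᴰ) = Pᴰ(0|1), with the testable implications Pᴰ(0|0) ≥ Pᴰ(0|1) and Pᴰ(0|0) ≥ Pᴰ(0|2); moreover, with p := P(Cᴰ_{011}), one has P(Cᴰ_{010}) = Pᴰ(0|0) − Pᴰ(0|1) − p, P(Cᴰ_{001}) = Pᴰ(0|0) − Pᴰ(0|2) − p,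 P(A₀ᴰ) = Pᴰ(0|2) + Pᴰ(0|1) − Pᴰ(0|0) + p, and max(0, Pᴰ(0|0) − Pᴰ(0|1) − Pᴰ(0|2)) ≤ p ≤ Pᴰ(0|0) − max(Pᴰ(0|1), Pᴰ(0|2)); (ii) assuming positive denominators: E[Yᴰ(0) | Cᴰ_{001} ∪ A₀ᴰ] = Ēᴰ_1(0) / Pᴰ(0|1), E[Yᴰ(0) | Cᴰ_{010} ∪ Cᴰ_{011}] = (Ēᴰ_0(0) − Ēᴰ_1(0)) / (Pᴰ(0|0) − Pᴰ(0|1)), E[Yᴰ(1) | Cᴰ_{010} ∪ Cᴰ_{011}] = (Ēᴰ_1(1) − Ēᴰ_0(1)) / (Pᴰ(0|0) − Pᴰ(0|1)), and E[Yᴰ(1) | A₁ᴰ] = Ēᴰ_0(1) / Pᴰ(1|0); (iii) the Wald estimands identify the LATEs: E[Yᴰ(1) − Yᴰ(0) | Cᴰ_{010} ∪ Cᴰ_{011}] = (E[Y | Z = 1] − E[Y | Z = 0]) / (Pᴰ(1|1) − Pᴰ(1|0)) and E[Yᴰ(1) − Yᴰ(0) | Cᴰ_{001} ∪ Cᴰ_{011}]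 = (E[Y | Z = 2] − E[Y | Z = 0]) / (Pᴰ(1|2) − Pᴰ(1|0)). -/
open MeasureTheory ProbabilityTheory

noncomputable section

variable {Ω : Type*} [MeasurableSpace Ω]

/-- The binary filter of the 3×3 model: `M(0) = 0`, `M(1) = M(2) = 1`. -/
def mflt (t : Fin 3) : ℕ := if t = 0 then 0 else 1

lemma measurable_mflt : Measurable mflt := measurable_of_countable mflt

lemma prr_eq_setIntegral (P : Measure Ω) (A : Set Ω) : prr P A = ∫ _ in A, (1 : ℝ) ∂P := by
  rw [setIntegral_one_eq_measureReal]; rfl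

/-- Evaluating a family at a random index is measurable. -/
lemma measurable_eval_index {ι : Type*} [Fintype ι] [DecidableEq ι] [MeasurableSpace ι]
    [MeasurableSingletonClass ι] {α : Type*} [MeasurableSpace α] {τ : α → ι} {f : ι → α → ℝ}
    (hτ : Measurable τ) (hf : ∀ i, Measurable (f i)) : Measurable fun a => f (τ a) a := by
  have h : (fun a => f (τ a) a) = fun a => ∑ i, if τ a = i then f i a else 0 := by
    funext a
    rw [Fintype.sum_ite_eq]
  rw [h]
  exact Finset.measurable_fun_sum _ fun i _ =>
    Measurable.ite (hτ (measurableSet_singleton i)) (hf i) measurable_const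

/-- Evaluating a finite integrable family at a random index is integrable. -/
lemma integrable_eval_index {ι : Type*} [Fintype ι] [MeasurableSpace ι]
    [MeasurableSingletonClass ι] {P : Measure Ω} {τ : Ω → ι} {f : ι → Ω → ℝ}
    (hτ : Measurable τ) (hf : ∀ i, Integrable (f i) P) :
    Integrable (fun ω => f (τ ω) ω) P := by
  classical
  have h : (fun ω => f (τ ω) ω) = fun ω => ∑ i, (τ ⁻¹' {i}).indicator (f i) ω := by
    funext ω
    simp [Set.indicator_apply]
  rw [h]
  exact integrable_finsetSum _ fun i _ => (hf i).indicator (hτ (measurableSet_singleton i))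

/-- Conditioning on an instrument independent of `W` does not affect integrals of functions
of `W`. -/
lemma setIntegral_inter_div_of_indepFun {𝒲 𝒵 : Type*} [MeasurableSpace 𝒲] [MeasurableSpace 𝒵]
    [MeasurableSingletonClass 𝒵] {P : Measure Ω} [IsProbabilityMeasure P]
    {Z : Ω → 𝒵} {W : Ω → 𝒲} (hZ : Measurable Z) (hW : Measurable W) (hZW : IndepFun Z W P)
    {g : 𝒲 → ℝ} (hg : Measurable g) {S : Set 𝒲} (hS : MeasurableSet S)
    {z : 𝒵} (hz : 0 < P {ω | Z ω = z}) :
    (∫ ω in W ⁻¹' S ∩ {ω | Z ω = z}, g (W ω) ∂P) / prr P {ω | Z ω = z}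
      = ∫ ω in W ⁻¹' S, g (W ω) ∂P := by
  have hm : MeasurableSet {ω | Z ω = z} := hZ (measurableSet_singleton z)
  have hz' : prr P {ω | Z ω = z} ≠ 0 := (ENNReal.toReal_pos hz.ne' (measure_ne_top P _)).ne'
  rw [div_eq_iff hz', mul_comm]
  have key := hZW.integral_fun_comp_mul_comp (f := ({z} : Set 𝒵).indicator (fun _ => (1 : ℝ)))
    (g := S.indicator g) hZ.aemeasurable hW.aemeasurable
    (measurable_const.indicator (measurableSet_singleton z)).aestronglyMeasurable
    (hg.indicator hS).aestronglyMeasurable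
  rw [prr_eq_setIntegral, ← integral_indicator hm, ← integral_indicator (hW hS),
    ← integral_indicator ((hW hS).inter hm)]
  refine Eq.trans (integral_congr_ae (.of_forall fun ω => ?_)) key
  by_cases h1 : Z ω = z <;> by_cases h2 : W ω ∈ S <;> simp [h1, h2]

/-- Splitting a set integral along an almost sure two-set partition. -/
lemma setIntegral_eq_add_of_ae {P : Measure Ω} {X : Ω → ℝ} (hX : Integrable X P)
    {S A B : Set Ω} (hB : MeasurableSet B) (hAB : Disjoint A B)
    (h : ∀ᵐ ω ∂P, ω ∈ S ↔ ω ∈ A ∪ B) :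
    ∫ ω in S, X ω ∂P = (∫ ω in A, X ω ∂P) + ∫ ω in B, X ω ∂P := by
  rw [setIntegral_congr_set (Filter.eventuallyEq_set.2 h),
    setIntegral_union hAB hB hX.integrableOn hX.integrableOn]

/-- In the ARUM, an instrument that weakly raises the relative utilities of all treatments
weakly increases participation. -/
lemma filtered_choice_monotone {U : Fin 3 → Fin 3 → ℝ} {v : Fin 3 → ℝ} {τ : Fin 3 → Fin 3}
    (hmax : ∀ z t, t ≠ τ z → U z t + v t < U z (τ z) + v (τ z)) {z z' : Fin 3}
    (hΔ : ∀ t, U z t - U z 0 ≤ U z' t - U z' 0) (h : mflt (τ z) = 1) :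
    mflt (τ z') = 1 := by
  have hz : τ z ≠ 0 := fun h0 => by simp [mflt, h0] at h
  have hz' : τ z' ≠ 0 := fun h0 => by
    have h1 := hmax z 0 hz.symm
    have h2 := hmax z' (τ z) (by rw [h0]; exact hz)
    rw [h0] at h2
    linarith [hΔ (τ z)]
  simp [mflt, hz']

lemma mflt_eq_zero_or_one (t : Fin 3) : mflt t = 0 ∨ mflt t = 1 := by
  unfold mflt; split_ifs <;> simp

lemma eval_eq_of_mflt_eq_one {y : Fin 3 → ℝ} (hy : y 1 = y 2) {t : Fin 3} (ht : mflt t = 1) :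
    y t = y 1 := by
  fin_cases t
  · simp [mflt] at ht
  · rfl
  · exact hy.symm

/-- Proposition (identification in the 3×2-filtered 3×3 model). -/
theorem statement18
    (P : Measure Ω) [IsProbabilityMeasure P]
    (T : Fin 3 → Ω → Fin 3) (Z : Ω → Fin 3) (Y : Fin 3 → Ω → ℝ)
    (U : Fin 3 → Fin 3 → ℝ) (u : Fin 3 → Ω → ℝ)
    (hTmeas : ∀ z, Measurable (T z)) (hZmeas : Measurable Z)
    (hYmeas : ∀ t, Measurable (Y t)) (hYint : ∀ t, Integrable (Y t) P)
    (humeas : ∀ t, Measurable (u t))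
    (hZpos : ∀ z, 0 < P {ω | Z ω = z})
    (hindep : IndepFun Z
      (fun ω => ((fun z => T z ω), (fun t => Y t ω), (fun t => u t ω))) P)
    (hmax : ∀ᵐ ω ∂P, ∀ z t, t ≠ T z ω →
      U z t + u t ω < U z (T z ω) + u (T z ω) ω)
    (hΔ11 : U 0 1 - U 0 0 < U 1 1 - U 1 0)
    (hΔ21 : U 0 1 - U 0 0 = U 2 1 - U 2 0)
    (hΔ22 : U 0 2 - U 0 0 < U 2 2 - U 2 0)
    (hΔ12 : U 0 2 - U 0 0 = U 1 2 - U 1 0)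
    -- filtered counterfactual outcomes: Y(1) = Y(2) almost surely
    (hY12 : ∀ᵐ ω ∂P, Y 1 ω = Y 2 ω)
    -- positive denominators and conditioning probabilities for parts (ii)-(iii)
    (hden1 : 0 < pscore P (fun ω => mflt (T (Z ω) ω)) Z 0 1)
    (hden2 : 0 < pscore P (fun ω => mflt (T (Z ω) ω)) Z 0 0
        - pscore P (fun ω => mflt (T (Z ω) ω)) Z 0 1)
    (hden3 : 0 < pscore P (fun ω => mflt (T (Z ω) ω)) Z 1 0)
    (hden4 : 0 < pscore P (fun ω => mflt (T (Z ω) ω)) Z 1 1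
        - pscore P (fun ω => mflt (T (Z ω) ω)) Z 1 0)
    (hden5 : 0 < pscore P (fun ω => mflt (T (Z ω) ω)) Z 1 2
        - pscore P (fun ω => mflt (T (Z ω) ω)) Z 1 0)
    (hpos1 : 0 < P ({ω | mflt (T 0 ω) = 0 ∧ mflt (T 1 ω) = 0 ∧ mflt (T 2 ω) = 1}
        ∪ {ω | ∀ z, mflt (T z ω) = 0}))
    (hpos2 : 0 < P ({ω | mflt (T 0 ω) = 0 ∧ mflt (T 1 ω) = 1 ∧ mflt (T 2 ω) = 0}
        ∪ {ω | mflt (T 0 ω) = 0 ∧ mflt (T 1 ω) = 1 ∧ mflt (T 2 ω) = 1}))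
    (hpos3 : 0 < P ({ω | mflt (T 0 ω) = 0 ∧ mflt (T 1 ω) = 0 ∧ mflt (T 2 ω) = 1}
        ∪ {ω | mflt (T 0 ω) = 0 ∧ mflt (T 1 ω) = 1 ∧ mflt (T 2 ω) = 1}))
    (hpos4 : 0 < P {ω | ∀ z, mflt (T z ω) = 1}) :
    -- (i) group probabilities
    prr P {ω | ∀ z, mflt (T z ω) = 1} = pscore P (fun ω => mflt (T (Z ω) ω)) Z 1 0
    ∧ prr P {ω | mflt (T 0 ω) = 0 ∧ mflt (T 1 ω) = 1 ∧ mflt (T 2 ω) = 0}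
        + prr P {ω | mflt (T 0 ω) = 0 ∧ mflt (T 1 ω) = 1 ∧ mflt (T 2 ω) = 1}
      = pscore P (fun ω => mflt (T (Z ω) ω)) Z 0 0
        - pscore P (fun ω => mflt (T (Z ω) ω)) Z 0 1
    ∧ prr P {ω | mflt (T 0 ω) = 0 ∧ mflt (T 1 ω) = 0 ∧ mflt (T 2 ω) = 1}
        + prr P {ω | mflt (T 0 ω) = 0 ∧ mflt (T 1 ω) = 1 ∧ mflt (T 2 ω) = 1}
      = pscore P (fun ω => mflt (T (Z ω) ω)) Z 0 0
        - pscore P (fun ω => mflt (T (Z ω) ω)) Z 0 2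
    ∧ prr P {ω | mflt (T 0 ω) = 0 ∧ mflt (T 1 ω) = 0 ∧ mflt (T 2 ω) = 1}
        + prr P {ω | ∀ z, mflt (T z ω) = 0}
      = pscore P (fun ω => mflt (T (Z ω) ω)) Z 0 1
    -- testable implications
    ∧ pscore P (fun ω => mflt (T (Z ω) ω)) Z 0 1 ≤ pscore P (fun ω => mflt (T (Z ω) ω)) Z 0 0
    ∧ pscore P (fun ω => mflt (T (Z ω) ω)) Z 0 2 ≤ pscore P (fun ω => mflt (T (Z ω) ω)) Z 0 0
    -- parameterization by p = P(Cᴰ₀₁₁)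
    ∧ prr P {ω | mflt (T 0 ω) = 0 ∧ mflt (T 1 ω) = 1 ∧ mflt (T 2 ω) = 0}
        = pscore P (fun ω => mflt (T (Z ω) ω)) Z 0 0
          - pscore P (fun ω => mflt (T (Z ω) ω)) Z 0 1
          - prr P {ω | mflt (T 0 ω) = 0 ∧ mflt (T 1 ω) = 1 ∧ mflt (T 2 ω) = 1}
    ∧ prr P {ω | mflt (T 0 ω) = 0 ∧ mflt (T 1 ω) = 0 ∧ mflt (T 2 ω) = 1}
        = pscore P (fun ω => mflt (T (Z ω) ω)) Z 0 0
          - pscore P (fun ω => mflt (T (Z ω) ω)) Z 0 2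
          - prr P {ω | mflt (T 0 ω) = 0 ∧ mflt (T 1 ω) = 1 ∧ mflt (T 2 ω) = 1}
    ∧ prr P {ω | ∀ z, mflt (T z ω) = 0}
        = pscore P (fun ω => mflt (T (Z ω) ω)) Z 0 2
          + pscore P (fun ω => mflt (T (Z ω) ω)) Z 0 1
          - pscore P (fun ω => mflt (T (Z ω) ω)) Z 0 0
          + prr P {ω | mflt (T 0 ω) = 0 ∧ mflt (T 1 ω) = 1 ∧ mflt (T 2 ω) = 1}
    ∧ max 0 (pscore P (fun ω => mflt (T (Z ω) ω)) Z 0 0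
          - pscore P (fun ω => mflt (T (Z ω) ω)) Z 0 1
          - pscore P (fun ω => mflt (T (Z ω) ω)) Z 0 2)
        ≤ prr P {ω | mflt (T 0 ω) = 0 ∧ mflt (T 1 ω) = 1 ∧ mflt (T 2 ω) = 1}
    ∧ prr P {ω | mflt (T 0 ω) = 0 ∧ mflt (T 1 ω) = 1 ∧ mflt (T 2 ω) = 1}
        ≤ pscore P (fun ω => mflt (T (Z ω) ω)) Z 0 0
          - max (pscore P (fun ω => mflt (T (Z ω) ω)) Z 0 1)
              (pscore P (fun ω => mflt (T (Z ω) ω)) Z 0 2)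
    -- (ii) counterfactual means
    ∧ cexp P (Y 0) ({ω | mflt (T 0 ω) = 0 ∧ mflt (T 1 ω) = 0 ∧ mflt (T 2 ω) = 1}
          ∪ {ω | ∀ z, mflt (T z ω) = 0})
        = ebar P (fun ω => mflt (T (Z ω) ω)) Z (fun ω => Y (T (Z ω) ω) ω) 1 0
          / pscore P (fun ω => mflt (T (Z ω) ω)) Z 0 1
    ∧ cexp P (Y 0) ({ω | mflt (T 0 ω) = 0 ∧ mflt (T 1 ω) = 1 ∧ mflt (T 2 ω) = 0}
          ∪ {ω | mflt (T 0 ω) = 0 ∧ mflt (T 1 ω) = 1 ∧ mflt (T 2 ω) = 1})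
        = (ebar P (fun ω => mflt (T (Z ω) ω)) Z (fun ω => Y (T (Z ω) ω) ω) 0 0
            - ebar P (fun ω => mflt (T (Z ω) ω)) Z (fun ω => Y (T (Z ω) ω) ω) 1 0)
          / (pscore P (fun ω => mflt (T (Z ω) ω)) Z 0 0
            - pscore P (fun ω => mflt (T (Z ω) ω)) Z 0 1)
    ∧ cexp P (Y 1) ({ω | mflt (T 0 ω) = 0 ∧ mflt (T 1 ω) = 1 ∧ mflt (T 2 ω) = 0}
          ∪ {ω | mflt (T 0 ω) = 0 ∧ mflt (T 1 ω) = 1 ∧ mflt (T 2 ω) = 1})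
        = (ebar P (fun ω => mflt (T (Z ω) ω)) Z (fun ω => Y (T (Z ω) ω) ω) 1 1
            - ebar P (fun ω => mflt (T (Z ω) ω)) Z (fun ω => Y (T (Z ω) ω) ω) 0 1)
          / (pscore P (fun ω => mflt (T (Z ω) ω)) Z 0 0
            - pscore P (fun ω => mflt (T (Z ω) ω)) Z 0 1)
    ∧ cexp P (Y 1) {ω | ∀ z, mflt (T z ω) = 1}
        = ebar P (fun ω => mflt (T (Z ω) ω)) Z (fun ω => Y (T (Z ω) ω) ω) 0 1
          / pscore P (fun ω => mflt (T (Z ω) ω)) Z 1 0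
    -- (iii) Wald estimands identify the LATEs
    ∧ cexp P (fun ω => Y 1 ω - Y 0 ω)
          ({ω | mflt (T 0 ω) = 0 ∧ mflt (T 1 ω) = 1 ∧ mflt (T 2 ω) = 0}
            ∪ {ω | mflt (T 0 ω) = 0 ∧ mflt (T 1 ω) = 1 ∧ mflt (T 2 ω) = 1})
        = (ecz P Z (fun ω => Y (T (Z ω) ω) ω) 1 - ecz P Z (fun ω => Y (T (Z ω) ω) ω) 0)
          / (pscore P (fun ω => mflt (T (Z ω) ω)) Z 1 1
            - pscore P (fun ω => mflt (T (Z ω) ω)) Z 1 0)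
    ∧ cexp P (fun ω => Y 1 ω - Y 0 ω)
          ({ω | mflt (T 0 ω) = 0 ∧ mflt (T 1 ω) = 0 ∧ mflt (T 2 ω) = 1}
            ∪ {ω | mflt (T 0 ω) = 0 ∧ mflt (T 1 ω) = 1 ∧ mflt (T 2 ω) = 1})
        = (ecz P Z (fun ω => Y (T (Z ω) ω) ω) 2 - ecz P Z (fun ω => Y (T (Z ω) ω) ω) 0)
          / (pscore P (fun ω => mflt (T (Z ω) ω)) Z 1 2
            - pscore P (fun ω => mflt (T (Z ω) ω)) Z 1 0) := by
  let W : Ω → (Fin 3 → Fin 3) × (Fin 3 → ℝ) × (Fin 3 → ℝ) :=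
    fun ω => ((fun z => T z ω), (fun t => Y t ω), (fun t => u t ω))
  have hW : Measurable W :=
    (measurable_pi_lambda _ hTmeas).prodMk
      ((measurable_pi_lambda _ hYmeas).prodMk (measurable_pi_lambda _ humeas))
  have hDmeas (z : Fin 3) (d : ℕ) : MeasurableSet {ω | mflt (T z ω) = d} :=
    (measurable_mflt.comp (hTmeas z)) (measurableSet_singleton d)
  have hSmeas (z : Fin 3) (d : ℕ) :
      MeasurableSet {w : (Fin 3 → Fin 3) × (Fin 3 → ℝ) × (Fin 3 → ℝ) | mflt (w.1 z) = d} :=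
    (measurable_mflt.comp ((measurable_pi_apply z).comp measurable_fst))
      (measurableSet_singleton d)
  have hgmeas (z : Fin 3) :
      Measurable fun w : (Fin 3 → Fin 3) × (Fin 3 → ℝ) × (Fin 3 → ℝ) => w.2.1 (w.1 z) :=
    measurable_eval_index (f := fun t (w : (Fin 3 → Fin 3) × (Fin 3 → ℝ) × (Fin 3 → ℝ)) => w.2.1 t)
      ((measurable_pi_apply z).comp measurable_fst)
      fun t => (measurable_pi_apply t).comp (measurable_fst.comp measurable_snd)
  have hobs (z : Fin 3) (d : ℕ) : {ω | mflt (T (Z ω) ω) = d} ∩ {ω | Z ω = z}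
      = W ⁻¹' {w | mflt (w.1 z) = d} ∩ {ω | Z ω = z} := by
    ext ω
    refine and_congr_left fun h => ?_
    have h : Z ω = z := h
    simp [W, h]
  have hZm (z : Fin 3) : MeasurableSet {ω | Z ω = z} := hZmeas (measurableSet_singleton z)
  have hYTint (z : Fin 3) : Integrable (fun ω => Y (T z ω) ω) P :=
    integrable_eval_index (hTmeas z) hYint
  -- Observed conditional moments equal counterfactual ones.
  have hp (d : ℕ) (z : Fin 3) : pscore P (fun ω => mflt (T (Z ω) ω)) Z d z
      = ∫ _ in {ω | mflt (T z ω) = d}, (1 : ℝ) ∂P := by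
    rw [pscore, hobs, prr_eq_setIntegral]
    exact setIntegral_inter_div_of_indepFun hZmeas hW hindep (g := fun _ => 1)
      measurable_const (hSmeas z d) (hZpos z)
  have hYobs (z : Fin 3) {S : Set Ω} (hS : MeasurableSet S) :
      ∫ ω in S ∩ {ω | Z ω = z}, Y (T (Z ω) ω) ω ∂P
        = ∫ ω in S ∩ {ω | Z ω = z}, Y (T z ω) ω ∂P :=
    setIntegral_congr_fun (hS.inter (hZm z)) fun ω hω => by
      have h : Z ω = z := hω.2
      simp [h]
  have he (d : ℕ) (z : Fin 3) :
      ebar P (fun ω => mflt (T (Z ω) ω)) Z (fun ω => Y (T (Z ω) ω) ω) z d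
        = ∫ ω in {ω | mflt (T z ω) = d}, Y (T z ω) ω ∂P := by
    rw [ebar, hobs, hYobs z (hW (hSmeas z d))]
    exact setIntegral_inter_div_of_indepFun hZmeas hW hindep (hgmeas z) (hSmeas z d) (hZpos z)
  have he0 (z : Fin 3) :
      ∫ ω in {ω | mflt (T z ω) = 0}, Y (T z ω) ω ∂P
        = ∫ ω in {ω | mflt (T z ω) = 0}, Y 0 ω ∂P :=
    setIntegral_congr_fun (hDmeas z 0) fun ω hω => by
      have h : T z ω = 0 := by
        by_contra h
        simp [mflt, h] at hω
      simp [h]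
  have he1 (z : Fin 3) :
      ∫ ω in {ω | mflt (T z ω) = 1}, Y (T z ω) ω ∂P
        = ∫ ω in {ω | mflt (T z ω) = 1}, Y 1 ω ∂P := by
    refine setIntegral_congr_ae (hDmeas z 1) (hY12.mono fun ω h12 hω => ?_)
    exact eval_eq_of_mflt_eq_one (y := fun t => Y t ω) h12 hω
  have hc (z : Fin 3) : ecz P Z (fun ω => Y (T (Z ω) ω) ω) z
      = (∫ ω in {ω | mflt (T z ω) = 0}, Y 0 ω ∂P)
        + ∫ ω in {ω | mflt (T z ω) = 1}, Y 1 ω ∂P := by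
    have h := setIntegral_inter_div_of_indepFun hZmeas hW hindep (hgmeas z)
      MeasurableSet.univ (hZpos z)
    have h' := hYobs z MeasurableSet.univ
    rw [Set.preimage_univ] at h
    rw [Set.univ_inter] at h h'
    rw [ecz, h', ← he0, ← he1]
    refine h.trans (setIntegral_eq_add_of_ae (hYTint z) (hDmeas z 1) ?_ (.of_forall fun ω => ?_))
    · exact Set.disjoint_left.2 fun ω h0 h1 => zero_ne_one (h0.symm.trans h1)
    · exact iff_of_true trivial (mflt_eq_zero_or_one (T z ω))
  -- Response groups.
  have hmono : ∀ᵐ ω ∂P, (mflt (T 0 ω) = 1 → mflt (T 1 ω) = 1)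
      ∧ (mflt (T 0 ω) = 1 → mflt (T 2 ω) = 1) := by
    filter_upwards [hmax] with ω hω
    constructor <;>
    · refine filtered_choice_monotone (τ := fun z => T z ω) hω fun t => ?_
      fin_cases t <;> simp <;> linarith
  set A1 := {ω | ∀ z, mflt (T z ω) = 1} with hA1
  set A0 := {ω | ∀ z, mflt (T z ω) = 0} with hA0
  set C010 := {ω | mflt (T 0 ω) = 0 ∧ mflt (T 1 ω) = 1 ∧ mflt (T 2 ω) = 0} with hC010
  set C001 := {ω | mflt (T 0 ω) = 0 ∧ mflt (T 1 ω) = 0 ∧ mflt (T 2 ω) = 1} with hC001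
  set C011 := {ω | mflt (T 0 ω) = 0 ∧ mflt (T 1 ω) = 1 ∧ mflt (T 2 ω) = 1} with hC011
  have mA1 : MeasurableSet A1 := by
    rw [hA1, Set.ofPred_forall]; exact .iInter fun z => hDmeas z 1
  have mA0 : MeasurableSet A0 := by
    rw [hA0, Set.ofPred_forall]; exact .iInter fun z => hDmeas z 0
  have mC010 : MeasurableSet C010 := (hDmeas 0 0).inter ((hDmeas 1 1).inter (hDmeas 2 0))
  have mC001 : MeasurableSet C001 := (hDmeas 0 0).inter ((hDmeas 1 0).inter (hDmeas 2 1))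
  have mC011 : MeasurableSet C011 := (hDmeas 0 0).inter ((hDmeas 1 1).inter (hDmeas 2 1))
  have hcover : ∀ᵐ ω ∂P,
      (ω ∈ {ω | mflt (T 0 ω) = 1} ↔ ω ∈ A1) ∧
      (ω ∈ {ω | mflt (T 0 ω) = 0} ↔ ω ∈ (C001 ∪ A0) ∪ (C010 ∪ C011)) ∧
      (ω ∈ {ω | mflt (T 1 ω) = 0} ↔ ω ∈ C001 ∪ A0) ∧
      (ω ∈ {ω | mflt (T 1 ω) = 1} ↔ ω ∈ (C010 ∪ C011) ∪ A1) ∧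
      (ω ∈ {ω | mflt (T 2 ω) = 0} ↔ ω ∈ C010 ∪ A0) ∧
      (ω ∈ {ω | mflt (T 2 ω) = 1} ↔ ω ∈ (C001 ∪ C011) ∪ A1) := by
    filter_upwards [hmono] with ω ⟨h1, h2⟩
    simp only [hA1, hA0, hC010, hC001, hC011, Set.mem_union, Set.mem_ofPred_eq, Fin.forall_fin_succ,
      Fin.isValue, Fin.succ_zero_eq_one, Fin.succ_one_eq_two, IsEmpty.forall_iff, and_true]
    have a := mflt_eq_zero_or_one (T 0 ω)
    have b := mflt_eq_zero_or_one (T 1 ω)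
    have c := mflt_eq_zero_or_one (T 2 ω)
    refine ⟨?_, ?_, ?_, ?_, ?_, ?_⟩ <;> omega
  have d1 : Disjoint C001 A0 := Set.disjoint_left.2 fun ω h h' => by
    have := h.2.2; have := h' 2; omega
  have d2 : Disjoint C010 C011 := Set.disjoint_left.2 fun ω h h' => by
    have := h.2.2; have := h'.2.2; omega
  have d3 : Disjoint C001 C011 := Set.disjoint_left.2 fun ω h h' => by
    have := h.2.1; have := h'.2.1; omega
  have d4 : Disjoint C010 A0 := Set.disjoint_left.2 fun ω h h' => by
    have := h.2.1; have := h' 1; omega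
  have d5 : Disjoint (C001 ∪ A0) (C010 ∪ C011) := Set.disjoint_left.2 fun ω h h' => by
    have h1 : mflt (T 1 ω) = 0 := h.elim (fun h => h.2.1) fun h => h 1
    have h2 : mflt (T 1 ω) = 1 := h'.elim (fun h => h.2.1) fun h => h.2.1
    omega
  have d6 : Disjoint (C010 ∪ C011) A1 := Set.disjoint_left.2 fun ω h h' => by
    have h1 : mflt (T 0 ω) = 0 := h.elim And.left And.left
    have := h' 0; omega
  have d7 : Disjoint (C001 ∪ C011) A1 := Set.disjoint_left.2 fun ω h h' => by
    have h1 : mflt (T 0 ω) = 0 := h.elim And.left And.left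
    have := h' 0; omega
  have split {X : Ω → ℝ} (hX : Integrable X P) :
      (∫ ω in {ω | mflt (T 0 ω) = 1}, X ω ∂P = ∫ ω in A1, X ω ∂P) ∧
      (∫ ω in {ω | mflt (T 0 ω) = 0}, X ω ∂P
        = (∫ ω in C001 ∪ A0, X ω ∂P) + ∫ ω in C010 ∪ C011, X ω ∂P) ∧
      (∫ ω in {ω | mflt (T 1 ω) = 0}, X ω ∂P = ∫ ω in C001 ∪ A0, X ω ∂P) ∧
      (∫ ω in {ω | mflt (T 1 ω) = 1}, X ω ∂P
        = (∫ ω in C010 ∪ C011, X ω ∂P) + ∫ ω in A1, X ω ∂P) ∧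
      (∫ ω in {ω | mflt (T 2 ω) = 0}, X ω ∂P
        = (∫ ω in C010, X ω ∂P) + ∫ ω in A0, X ω ∂P) ∧
      (∫ ω in {ω | mflt (T 2 ω) = 1}, X ω ∂P
        = (∫ ω in C001 ∪ C011, X ω ∂P) + ∫ ω in A1, X ω ∂P) ∧
      (∫ ω in C001 ∪ A0, X ω ∂P = (∫ ω in C001, X ω ∂P) + ∫ ω in A0, X ω ∂P) ∧
      (∫ ω in C010 ∪ C011, X ω ∂P = (∫ ω in C010, X ω ∂P) + ∫ ω in C011, X ω ∂P) ∧
      (∫ ω in C001 ∪ C011, X ω ∂P = (∫ ω in C001, X ω ∂P) + ∫ ω in C011, X ω ∂P) :=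
    ⟨setIntegral_congr_set (Filter.eventuallyEq_set.2 (hcover.mono fun _ h => h.1)),
      setIntegral_eq_add_of_ae hX (mC010.union mC011) d5 (hcover.mono fun _ h => h.2.1),
      setIntegral_congr_set (Filter.eventuallyEq_set.2 (hcover.mono fun _ h => h.2.2.1)),
      setIntegral_eq_add_of_ae hX mA1 d6 (hcover.mono fun _ h => h.2.2.2.1),
      setIntegral_eq_add_of_ae hX mA0 d4 (hcover.mono fun _ h => h.2.2.2.2.1),
      setIntegral_eq_add_of_ae hX mA1 d7 (hcover.mono fun _ h => h.2.2.2.2.2),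
      setIntegral_eq_add_of_ae hX mA0 d1 (.of_forall fun _ => Iff.rfl),
      setIntegral_eq_add_of_ae hX mC011 d2 (.of_forall fun _ => Iff.rfl),
      setIntegral_eq_add_of_ae hX mC011 d3 (.of_forall fun _ => Iff.rfl)⟩
  have nonneg (S : Set Ω) : 0 ≤ ∫ _ in S, (1 : ℝ) ∂P :=
    integral_nonneg fun _ => zero_le_one
  have sub (S : Set Ω) : ∫ ω in S, (Y 1 ω - Y 0 ω) ∂P
      = (∫ ω in S, Y 1 ω ∂P) - ∫ ω in S, Y 0 ω ∂P :=
    integral_sub (hYint 1).integrableOn (hYint 0).integrableOn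
  obtain ⟨p1, p2, p3, p4, p5, p6, p7, p8, p9⟩ := split (integrable_const (1 : ℝ))
  obtain ⟨a1, a2, a3, a4, a5, a6, a7, a8, a9⟩ := split (hYint 0)
  obtain ⟨b1, b2, b3, b4, b5, b6, b7, b8, b9⟩ := split (hYint 1)
  have n1 := nonneg C010
  have n2 := nonneg C001
  have n3 := nonneg C011
  have n4 := nonneg A0
  simp only [cexp, hp, he, hc, he0, he1, sub, prr_eq_setIntegral]
  refine ⟨?_, ?_, ?_, ?_, ?_, ?_, ?_, ?_, ?_, max_le ?_ ?_, le_sub_comm.1 (max_le ?_ ?_),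
    ?_, ?_, ?_, ?_, ?_, ?_⟩
  iterate 13 linarith
  all_goals congr 1 <;> linarith
end
end

section
/- In the filtered factorial design: (i) the five D-response-group probabilities are point-identified: P(A₀ᴰ) = Pᴰ(0|1×1), P(A₁ᴰ) = Pᴰ(1|0×0), P(Cᴰ_{0011}) = Pᴰ(0|1×0) − Pᴰ(0|1×1), P(Cᴰ_{0101}) = Pᴰ(0|0×1) − Pᴰ(0|1×1), and P(Cᴰ_{0111}) = Pᴰ(0|0×0) + Pᴰ(0|1×1) − Pᴰ(0|1×0) − Pᴰ(0|0×1), with the testable implications Pᴰ(0|1×0) ≥ Pᴰ(0|1×1), Pᴰ(0|0×1) ≥ Pᴰ(0|1×1), and Pᴰ(0|0×0) + Pᴰ(0|1×1) ≥ Pᴰ(0|1×0) + Pᴰ(0|0×1); (ii) assuming positive group probabilities and nonzero denominators, the LATEs on the three complier groups are point-identified: E[Yᴰ(1) − Yᴰ(0) | Cᴰ_{0101}] = (E[Y | Z = 1×1] − E[Y | Z = 0×1]) / (Pᴰ(1|1×1) − Pᴰ(1|0×1)); E[Yᴰ(1) − Yᴰ(0) | Cᴰ_{0011}] = (E[Y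 | Z = 1×1] − E[Y | Z = 1×0]) / (Pᴰ(1|1×1) − Pᴰ(1|1×0)); and E[Yᴰ(1) − Yᴰ(0) | Cᴰ_{0111}] = (E[Y | Z = 1×0] + E[Y | Z = 0×1] − E[Y | Z = 1×1] − E[Y | Z = 0×0]) / (Pᴰ(1|1×0) + Pᴰ(1|0×1) − Pᴰ(1|1×1) − Pᴰ(1|0×0)). -/
open MeasureTheory ProbabilityTheory

noncomputable section

variable {Ω : Type*} [MeasurableSpace Ω]

/-- The binary filter of the factorial design: `D = 1(T ≠ 0)`. -/
def dflt (t : Fin 3) : ℕ := if t = 0 then 0 else 1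

open Set

/-- An integral over an event of an independent variable factorizes. -/
theorem setIntegral_comp_eq_prr_mul_integral {𝒵 E : Type*} [MeasurableSpace 𝒵]
    [MeasurableSingletonClass 𝒵] [MeasurableSpace E] {P : Measure Ω} {Z : Ω → 𝒵} {W : Ω → E}
    (hZ : Measurable Z) (hW : Measurable W) (hindep : IndepFun Z W P)
    {φ : E → ℝ} (hφ : Measurable φ) (z : 𝒵) :
    ∫ ω in {ω | Z ω = z}, φ (W ω) ∂P = prr P {ω | Z ω = z} * ∫ ω, φ (W ω) ∂P := by
  have hz : MeasurableSet {ω | Z ω = z} := hZ (measurableSet_singleton z)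
  have hone : Measurable (({z} : Set 𝒵).indicator (1 : 𝒵 → ℝ)) :=
    measurable_one.indicator (measurableSet_singleton z)
  have hprod := (hindep.comp hone hφ).integral_fun_mul_eq_mul_integral
    (hone.comp hZ).aestronglyMeasurable (hφ.comp hW).aestronglyMeasurable
  have hind : ({z} : Set 𝒵).indicator (1 : 𝒵 → ℝ) ∘ Z = {ω | Z ω = z}.indicator 1 := rfl
  rw [hind, integral_indicator_one hz] at hprod
  rw [← integral_indicator hz, prr, ← measureReal_def]
  refine Eq.trans ?_ hprod
  congr with ω
  by_cases h : Z ω = z <;> simp [h]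

/-- A conditional probability given an independent variable is unconditional. -/
theorem pscore_eq_prr {𝒟 𝒵 E : Type*} [MeasurableSpace 𝒵] [MeasurableSingletonClass 𝒵]
    [MeasurableSpace E] {P : Measure Ω} [IsFiniteMeasure P] {Z : Ω → 𝒵} {W : Ω → E}
    (hindep : IndepFun Z W P) {D : 𝒵 → E → 𝒟} {d : 𝒟} {z : 𝒵}
    (hD : MeasurableSet {x | D z x = d}) (hz : 0 < P {ω | Z ω = z}) :
    pscore P (fun ω => D (Z ω) (W ω)) Z d z = prr P {ω | D z (W ω) = d} := by
  have hset : {ω | D (Z ω) (W ω) = d} ∩ {ω | Z ω = z}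
      = Z ⁻¹' {z} ∩ W ⁻¹' {x | D z x = d} := by
    ext ω
    simp only [mem_inter_iff, mem_ofPred_eq, mem_preimage, mem_singleton_iff]
    constructor
    · rintro ⟨h, rfl⟩
      exact ⟨rfl, h⟩
    · rintro ⟨rfl, h⟩
      exact ⟨h, rfl⟩
  have hne : prr P {ω | Z ω = z} ≠ 0 :=
    (ENNReal.toReal_pos hz.ne' (measure_ne_top _ _)).ne'
  rw [pscore, div_eq_iff hne, hset, prr, prr, prr,
    hindep.measure_inter_preimage_eq_mul _ _ (measurableSet_singleton z) hD, ENNReal.toReal_mul,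
    mul_comm]
  rfl

/-- A conditional mean given an independent variable is unconditional. -/
theorem ecz_eq_integral {𝒵 E : Type*} [MeasurableSpace 𝒵] [MeasurableSingletonClass 𝒵]
    [MeasurableSpace E] {P : Measure Ω} [IsFiniteMeasure P] {Z : Ω → 𝒵} {W : Ω → E}
    (hZ : Measurable Z) (hW : Measurable W) (hindep : IndepFun Z W P) {φ : 𝒵 → E → ℝ} {z : 𝒵}
    (hφ : Measurable (φ z)) (hz : 0 < P {ω | Z ω = z}) :
    ecz P Z (fun ω => φ (Z ω) (W ω)) z = ∫ ω, φ z (W ω) ∂P := by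
  have hne : prr P {ω | Z ω = z} ≠ 0 :=
    (ENNReal.toReal_pos hz.ne' (measure_ne_top _ _)).ne'
  rw [ecz, div_eq_iff hne, mul_comm,
    ← setIntegral_comp_eq_prr_mul_integral hZ hW hindep hφ z]
  refine setIntegral_congr_fun (hZ (measurableSet_singleton z)) fun ω hω => ?_
  simp only [mem_ofPred_eq] at hω
  simp only [hω]

theorem dflt_eq_zero {t : Fin 3} : dflt t = 0 ↔ t = 0 := by
  simp [dflt]

theorem dflt_eq_one {t : Fin 3} : dflt t = 1 ↔ t ≠ 0 := by
  simp [dflt]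

/-- The strict maximizer of a utility over three options is `0` iff `0` beats both others. -/
theorem eq_zero_iff_of_forall_lt {v : Fin 3 → ℝ} {t : Fin 3} (h : ∀ s, s ≠ t → v s < v t) :
    t = 0 ↔ v 1 < v 0 ∧ v 2 < v 0 := by
  constructor
  · rintro rfl
    exact ⟨h 1 (by decide), h 2 (by decide)⟩
  · rintro ⟨h1, h2⟩
    by_contra h0
    have := h 0 (Ne.symm h0)
    fin_cases t
    · exact h0 rfl
    · exact lt_asymm this h1
    · exact lt_asymm this h2

/-- Membership in the three complier groups of the filtered factorial design, as linear
combinations of the binary responses. -/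
theorem ite_complier_eq {t : Fin 2 × Fin 2 → Fin 3}
    (h11 : t (1, 1) = 0 ↔ t (1, 0) = 0 ∧ t (0, 1) = 0)
    (h10 : t (1, 0) = 0 → t (0, 0) = 0) (h01 : t (0, 1) = 0 → t (0, 0) = 0) :
    (if dflt (t (0, 0)) = 0 ∧ dflt (t (1, 0)) = 0 ∧ dflt (t (0, 1)) = 1 ∧ dflt (t (1, 1)) = 1
      then (1 : ℝ) else 0) = dflt (t (1, 1)) - dflt (t (1, 0)) ∧
    (if dflt (t (0, 0)) = 0 ∧ dflt (t (0, 1)) = 0 ∧ dflt (t (1, 0)) = 1 ∧ dflt (t (1, 1)) = 1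
      then (1 : ℝ) else 0) = dflt (t (1, 1)) - dflt (t (0, 1)) ∧
    (if dflt (t (0, 0)) = 0 ∧ dflt (t (1, 0)) = 1 ∧ dflt (t (0, 1)) = 1 ∧ dflt (t (1, 1)) = 1
      then (1 : ℝ) else 0)
      = dflt (t (1, 0)) + dflt (t (0, 1)) - dflt (t (1, 1)) - dflt (t (0, 0)) := by
  by_cases h1 : t (1, 0) = 0 <;> by_cases h2 : t (0, 1) = 0 <;>
    by_cases h0 : t (0, 0) = 0 <;> simp_all [dflt]

/-- If the indicator of an event is a.s. an affine combination of bounded variables, integrals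
over the event are the corresponding combinations. -/
theorem setIntegral_eq_of_indicator_ae_eq {ι : Type*} [Fintype ι] {P : Measure Ω}
    {e : ι → Ω → ℝ} (he : ∀ i, Measurable (e i)) (hb : ∀ i ω, ‖e i ω‖ ≤ 1)
    {C : Set Ω} (hC : MeasurableSet C) {a : ℝ} {c : ι → ℝ}
    (h : ∀ᵐ ω ∂P, C.indicator (1 : Ω → ℝ) ω = a + ∑ i, c i * e i ω)
    {X : Ω → ℝ} (hX : Integrable X P) :
    ∫ ω in C, X ω ∂P = a * ∫ ω, X ω ∂P + ∑ i, c i * ∫ ω, e i ω * X ω ∂P := by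
  have hint : ∀ i, Integrable (fun ω => c i * (e i ω * X ω)) P := fun i =>
    (hX.bdd_mul (he i).aestronglyMeasurable (ae_of_all _ (hb i))).const_mul _
  have key : ∀ᵐ ω ∂P, C.indicator X ω = a * X ω + ∑ i, c i * (e i ω * X ω) := by
    filter_upwards [h] with ω hω
    have : C.indicator X ω = C.indicator (1 : Ω → ℝ) ω * X ω := by
      by_cases hm : ω ∈ C <;> simp [hm]
    rw [this, hω, add_mul, Finset.sum_mul]
    simp only [mul_assoc]
  rw [← integral_indicator hC, integral_congr_ae key,
    integral_add (hX.const_mul a) (integrable_finsetSum _ fun i _ => hint i),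
    integral_finsetSum _ fun i _ => hint i]
  simp only [integral_const_mul]

/-- Proposition (identifying the filtered factorial design model). -/
theorem statement19
    (P : Measure Ω) [IsProbabilityMeasure P]
    (T : Fin 2 × Fin 2 → Ω → Fin 3) (Z : Ω → Fin 2 × Fin 2) (Y : Fin 3 → Ω → ℝ)
    (U : Fin 2 × Fin 2 → Fin 3 → ℝ) (u : Fin 3 → Ω → ℝ)
    (hTmeas : ∀ z, Measurable (T z)) (hZmeas : Measurable Z)
    (hYmeas : ∀ t, Measurable (Y t)) (hYint : ∀ t, Integrable (Y t) P)
    (humeas : ∀ t, Measurable (u t))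
    (hZpos : ∀ z, 0 < P {ω | Z ω = z})
    (hindep : IndepFun Z
      (fun ω => ((fun z => T z ω), (fun t => Y t ω), (fun t => u t ω))) P)
    (hmax : ∀ᵐ ω ∂P, ∀ z t, t ≠ T z ω →
      U z t + u t ω < U z (T z ω) + u (T z ω) ω)
    -- Δ_{1×1}(1) = Δ_{1×0}(1) > Δ_{0×1}(1) = Δ_{0×0}(1)
    (hΔ1a : U (1, 1) 1 - U (1, 1) 0 = U (1, 0) 1 - U (1, 0) 0)
    (hΔ1b : U (0, 1) 1 - U (0, 1) 0 < U (1, 0) 1 - U (1, 0) 0)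
    (hΔ1c : U (0, 1) 1 - U (0, 1) 0 = U (0, 0) 1 - U (0, 0) 0)
    -- Δ_{1×1}(2) = Δ_{0×1}(2) > Δ_{1×0}(2) = Δ_{0×0}(2)
    (hΔ2a : U (1, 1) 2 - U (1, 1) 0 = U (0, 1) 2 - U (0, 1) 0)
    (hΔ2b : U (1, 0) 2 - U (1, 0) 0 < U (0, 1) 2 - U (0, 1) 0)
    (hΔ2c : U (1, 0) 2 - U (1, 0) 0 = U (0, 0) 2 - U (0, 0) 0)
    -- filtered counterfactual outcomes: Y(1) = Y(2) almost surely
    (hY12 : ∀ᵐ ω ∂P, Y 1 ω = Y 2 ω)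
    -- positive group probabilities for part (ii)
    (hA0 : 0 < P {ω | ∀ z, dflt (T z ω) = 0})
    (hA1 : 0 < P {ω | ∀ z, dflt (T z ω) = 1})
    (hC0011 : 0 < P {ω | dflt (T (0, 0) ω) = 0 ∧ dflt (T (1, 0) ω) = 0
        ∧ dflt (T (0, 1) ω) = 1 ∧ dflt (T (1, 1) ω) = 1})
    (hC0101 : 0 < P {ω | dflt (T (0, 0) ω) = 0 ∧ dflt (T (0, 1) ω) = 0
        ∧ dflt (T (1, 0) ω) = 1 ∧ dflt (T (1, 1) ω) = 1})
    (hC0111 : 0 < P {ω | dflt (T (0, 0) ω) = 0 ∧ dflt (T (1, 0) ω) = 1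
        ∧ dflt (T (0, 1) ω) = 1 ∧ dflt (T (1, 1) ω) = 1})
    -- nonzero denominators for part (ii)
    (hden1 : pscore P (fun ω => dflt (T (Z ω) ω)) Z 1 (1, 1)
        - pscore P (fun ω => dflt (T (Z ω) ω)) Z 1 (0, 1) ≠ 0)
    (hden2 : pscore P (fun ω => dflt (T (Z ω) ω)) Z 1 (1, 1)
        - pscore P (fun ω => dflt (T (Z ω) ω)) Z 1 (1, 0) ≠ 0)
    (hden3 : pscore P (fun ω => dflt (T (Z ω) ω)) Z 1 (1, 0)
        + pscore P (fun ω => dflt (T (Z ω) ω)) Z 1 (0, 1)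
        - pscore P (fun ω => dflt (T (Z ω) ω)) Z 1 (1, 1)
        - pscore P (fun ω => dflt (T (Z ω) ω)) Z 1 (0, 0) ≠ 0) :
    -- (i) the five D-response-group probabilities are point-identified
    prr P {ω | ∀ z, dflt (T z ω) = 0} = pscore P (fun ω => dflt (T (Z ω) ω)) Z 0 (1, 1)
    ∧ prr P {ω | ∀ z, dflt (T z ω) = 1} = pscore P (fun ω => dflt (T (Z ω) ω)) Z 1 (0, 0)
    ∧ prr P {ω | dflt (T (0, 0) ω) = 0 ∧ dflt (T (1, 0) ω) = 0
          ∧ dflt (T (0, 1) ω) = 1 ∧ dflt (T (1, 1) ω) = 1}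
        = pscore P (fun ω => dflt (T (Z ω) ω)) Z 0 (1, 0)
          - pscore P (fun ω => dflt (T (Z ω) ω)) Z 0 (1, 1)
    ∧ prr P {ω | dflt (T (0, 0) ω) = 0 ∧ dflt (T (0, 1) ω) = 0
          ∧ dflt (T (1, 0) ω) = 1 ∧ dflt (T (1, 1) ω) = 1}
        = pscore P (fun ω => dflt (T (Z ω) ω)) Z 0 (0, 1)
          - pscore P (fun ω => dflt (T (Z ω) ω)) Z 0 (1, 1)
    ∧ prr P {ω | dflt (T (0, 0) ω) = 0 ∧ dflt (T (1, 0) ω) = 1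
          ∧ dflt (T (0, 1) ω) = 1 ∧ dflt (T (1, 1) ω) = 1}
        = pscore P (fun ω => dflt (T (Z ω) ω)) Z 0 (0, 0)
          + pscore P (fun ω => dflt (T (Z ω) ω)) Z 0 (1, 1)
          - pscore P (fun ω => dflt (T (Z ω) ω)) Z 0 (1, 0)
          - pscore P (fun ω => dflt (T (Z ω) ω)) Z 0 (0, 1)
    -- testable implications
    ∧ pscore P (fun ω => dflt (T (Z ω) ω)) Z 0 (1, 1)
        ≤ pscore P (fun ω => dflt (T (Z ω) ω)) Z 0 (1, 0)
    ∧ pscore P (fun ω => dflt (T (Z ω) ω)) Z 0 (1, 1)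
        ≤ pscore P (fun ω => dflt (T (Z ω) ω)) Z 0 (0, 1)
    ∧ pscore P (fun ω => dflt (T (Z ω) ω)) Z 0 (1, 0)
          + pscore P (fun ω => dflt (T (Z ω) ω)) Z 0 (0, 1)
        ≤ pscore P (fun ω => dflt (T (Z ω) ω)) Z 0 (0, 0)
          + pscore P (fun ω => dflt (T (Z ω) ω)) Z 0 (1, 1)
    -- (ii) the LATEs on the three complier groups are point-identified
    ∧ cexp P (fun ω => Y 1 ω - Y 0 ω)
          {ω | dflt (T (0, 0) ω) = 0 ∧ dflt (T (0, 1) ω) = 0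
            ∧ dflt (T (1, 0) ω) = 1 ∧ dflt (T (1, 1) ω) = 1}
        = (ecz P Z (fun ω => Y (T (Z ω) ω) ω) (1, 1)
            - ecz P Z (fun ω => Y (T (Z ω) ω) ω) (0, 1))
          / (pscore P (fun ω => dflt (T (Z ω) ω)) Z 1 (1, 1)
            - pscore P (fun ω => dflt (T (Z ω) ω)) Z 1 (0, 1))
    ∧ cexp P (fun ω => Y 1 ω - Y 0 ω)
          {ω | dflt (T (0, 0) ω) = 0 ∧ dflt (T (1, 0) ω) = 0
            ∧ dflt (T (0, 1) ω) = 1 ∧ dflt (T (1, 1) ω) = 1}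
        = (ecz P Z (fun ω => Y (T (Z ω) ω) ω) (1, 1)
            - ecz P Z (fun ω => Y (T (Z ω) ω) ω) (1, 0))
          / (pscore P (fun ω => dflt (T (Z ω) ω)) Z 1 (1, 1)
            - pscore P (fun ω => dflt (T (Z ω) ω)) Z 1 (1, 0))
    ∧ cexp P (fun ω => Y 1 ω - Y 0 ω)
          {ω | dflt (T (0, 0) ω) = 0 ∧ dflt (T (1, 0) ω) = 1
            ∧ dflt (T (0, 1) ω) = 1 ∧ dflt (T (1, 1) ω) = 1}
        = (ecz P Z (fun ω => Y (T (Z ω) ω) ω) (1, 0)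
            + ecz P Z (fun ω => Y (T (Z ω) ω) ω) (0, 1)
            - ecz P Z (fun ω => Y (T (Z ω) ω) ω) (1, 1)
            - ecz P Z (fun ω => Y (T (Z ω) ω) ω) (0, 0))
          / (pscore P (fun ω => dflt (T (Z ω) ω)) Z 1 (1, 0)
            + pscore P (fun ω => dflt (T (Z ω) ω)) Z 1 (0, 1)
            - pscore P (fun ω => dflt (T (Z ω) ω)) Z 1 (1, 1)
            - pscore P (fun ω => dflt (T (Z ω) ω)) Z 1 (0, 0)) := by
  -- the binary treatment response as a real-valued variable
  set e : Fin 2 × Fin 2 → Ω → ℝ := fun z ω => (dflt (T z ω) : ℝ) with he_def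
  have he : ∀ z, Measurable (e z) := fun z =>
    (measurable_of_countable (fun t : Fin 3 => (dflt t : ℝ))).comp (hTmeas z)
  have hb : ∀ z ω, ‖e z ω‖ ≤ 1 := fun z ω => by
    by_cases h : T z ω = 0 <;> simp [he_def, dflt, h]
  have hD : ∀ z d, MeasurableSet {ω | dflt (T z ω) = d} := fun z d =>
    hTmeas z (to_countable {t | dflt t = d}).measurableSet
  have hW : Measurable fun ω => ((fun z => T z ω), (fun t => Y t ω), (fun t => u t ω)) :=
    (measurable_pi_lambda _ hTmeas).prodMk
      ((measurable_pi_lambda _ hYmeas).prodMk (measurable_pi_lambda _ humeas))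
  have hresp : ∀ᵐ ω ∂P, (T (1, 1) ω = 0 ↔ T (1, 0) ω = 0 ∧ T (0, 1) ω = 0) ∧
      (T (1, 0) ω = 0 → T (0, 0) ω = 0) ∧ (T (0, 1) ω = 0 → T (0, 0) ω = 0) := by
    filter_upwards [hmax] with ω hω
    have h : ∀ z, T z ω = 0 ↔ U z 1 + u 1 ω < U z 0 + u 0 ω ∧ U z 2 + u 2 ω < U z 0 + u 0 ω :=
      fun z => eq_zero_iff_of_forall_lt (v := fun t => U z t + u t ω) (hω z)
    simp only [h]
    refine ⟨⟨fun ⟨h1, h2⟩ => ⟨⟨?_, ?_⟩, ?_, ?_⟩, fun ⟨⟨h1, h2⟩, h3, h4⟩ => ⟨?_, ?_⟩⟩,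
      fun ⟨h1, h2⟩ => ⟨?_, ?_⟩, fun ⟨h1, h2⟩ => ⟨?_, ?_⟩⟩ <;> linarith
  -- observed moments as moments of counterfactuals
  have hmeas : ∀ z d, MeasurableSet
      {x : (Fin 2 × Fin 2 → Fin 3) × (Fin 3 → ℝ) × (Fin 3 → ℝ) | dflt (x.1 z) = d} :=
    fun z d => ((measurable_of_countable dflt).comp
      ((measurable_pi_apply z).comp measurable_fst)) (measurableSet_singleton d)
  have hps : ∀ d z, pscore P (fun ω => dflt (T (Z ω) ω)) Z d z = prr P {ω | dflt (T z ω) = d} :=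
    fun d z => pscore_eq_prr hindep (D := fun z x => dflt (x.1 z)) (hmeas z d) (hZpos z)
  have hφ : ∀ z : Fin 2 × Fin 2, Measurable
      fun x : (Fin 2 × Fin 2 → Fin 3) × (Fin 3 → ℝ) × (Fin 3 → ℝ) => x.2.1 (x.1 z) := fun z =>
    (measurable_from_prod_countable_left (f := fun p : (Fin 3 → ℝ) × Fin 3 => p.1 p.2)
      fun t => measurable_pi_apply t).comp
      (measurable_snd.fst.prodMk ((measurable_pi_apply z).comp measurable_fst))
  have hX : Integrable (fun ω => Y 1 ω - Y 0 ω) P := (hYint 1).sub (hYint 0)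
  have hY : ∀ z, ecz P Z (fun ω => Y (T (Z ω) ω) ω) z
      = ∫ ω, Y 0 ω ∂P + ∫ ω, e z ω * (Y 1 ω - Y 0 ω) ∂P := fun z => by
    rw [ecz_eq_integral hZmeas hW hindep (φ := fun z x => x.2.1 (x.1 z)) (hφ z) (hZpos z),
      ← integral_add (hYint 0)
        (hX.bdd_mul (he z).aestronglyMeasurable (ae_of_all _ (hb z)))]
    refine integral_congr_ae ?_
    filter_upwards [hY12] with ω hω
    have ht : T z ω = 0 ∨ T z ω = 1 ∨ T z ω = 2 := by
      generalize T z ω = t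
      revert t
      decide
    rcases ht with h | h | h <;> simp [he_def, dflt, h, hω]
  -- integrals and probabilities of events with affine indicators
  have hprr : ∀ {C : Set Ω} {a : ℝ} {c : Fin 2 × Fin 2 → ℝ}, MeasurableSet C →
      (∀ᵐ ω ∂P, C.indicator (1 : Ω → ℝ) ω = a + ∑ z, c z * e z ω) →
      prr P C = a + ∑ z, c z * ∫ ω, e z ω ∂P := fun hC h => by
    simpa [prr, measureReal_def] using
      setIntegral_eq_of_indicator_ae_eq he hb hC h (integrable_const (1 : ℝ))
  have hint := fun {C : Set Ω} {a : ℝ} {c : Fin 2 × Fin 2 → ℝ} (hC : MeasurableSet C)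
      (h : ∀ᵐ ω ∂P, C.indicator (1 : Ω → ℝ) ω = a + ∑ z, c z * e z ω) =>
    setIntegral_eq_of_indicator_ae_eq he hb hC h hX
  have hp1 : ∀ z, prr P {ω | dflt (T z ω) = 1} = ∫ ω, e z ω ∂P := fun z => by
    have h := hprr (a := 0) (c := Pi.single z 1) (hD z 1) (ae_of_all _ fun ω => by
      simp only [Pi.single_apply, ite_mul, zero_mul, Finset.sum_ite_eq', Finset.mem_univ, if_true]
      by_cases h : T z ω = 0 <;> simp [he_def, dflt, h])
    simpa [Pi.single_apply] using h
  have hp0 : ∀ z, prr P {ω | dflt (T z ω) = 0} = 1 - ∫ ω, e z ω ∂P := fun z => by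
    have h := hprr (a := 1) (c := Pi.single z (-1)) (hD z 0) (ae_of_all _ fun ω => by
      simp only [Pi.single_apply, ite_mul, zero_mul, Finset.sum_ite_eq', Finset.mem_univ, if_true]
      by_cases h : T z ω = 0 <;> simp [he_def, dflt, h])
    simpa [Pi.single_apply, sub_eq_add_neg] using h
  have hgroup : ∀ z₁ z₂ z₃ z₄ d₁ d₂ d₃ d₄, MeasurableSet {ω | dflt (T z₁ ω) = d₁ ∧
      dflt (T z₂ ω) = d₂ ∧ dflt (T z₃ ω) = d₃ ∧ dflt (T z₄ ω) = d₄} :=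
    fun z₁ z₂ z₃ z₄ d₁ d₂ d₃ d₄ =>
      (hD z₁ d₁).inter ((hD z₂ d₂).inter ((hD z₃ d₃).inter (hD z₄ d₄)))
  -- the indicators of the compliance groups, written with the response variables
  have hi0011 : ∀ᵐ ω ∂P, {ω | dflt (T (0, 0) ω) = 0 ∧ dflt (T (1, 0) ω) = 0
      ∧ dflt (T (0, 1) ω) = 1 ∧ dflt (T (1, 1) ω) = 1}.indicator (1 : Ω → ℝ) ω
      = 0 + ∑ z, (Pi.single (1, 1) 1 - Pi.single (1, 0) 1 : Fin 2 × Fin 2 → ℝ) z * e z ω := by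
    filter_upwards [hresp] with ω ⟨h1, h2, h3⟩
    rw [indicator_apply]
    refine (ite_complier_eq (t := fun z => T z ω) h1 h2 h3).1.trans ?_
    simp [he_def, Fintype.sum_prod_type, Pi.single_apply]
    ring
  have hi0101 : ∀ᵐ ω ∂P, {ω | dflt (T (0, 0) ω) = 0 ∧ dflt (T (0, 1) ω) = 0
      ∧ dflt (T (1, 0) ω) = 1 ∧ dflt (T (1, 1) ω) = 1}.indicator (1 : Ω → ℝ) ω
      = 0 + ∑ z, (Pi.single (1, 1) 1 - Pi.single (0, 1) 1 : Fin 2 × Fin 2 → ℝ) z * e z ω := by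
    filter_upwards [hresp] with ω ⟨h1, h2, h3⟩
    rw [indicator_apply]
    refine (ite_complier_eq (t := fun z => T z ω) h1 h2 h3).2.1.trans ?_
    simp [he_def, Fintype.sum_prod_type, Pi.single_apply]
    ring
  have hi0111 : ∀ᵐ ω ∂P, {ω | dflt (T (0, 0) ω) = 0 ∧ dflt (T (1, 0) ω) = 1
      ∧ dflt (T (0, 1) ω) = 1 ∧ dflt (T (1, 1) ω) = 1}.indicator (1 : Ω → ℝ) ω
      = 0 + ∑ z, (Pi.single (1, 0) 1 + Pi.single (0, 1) 1 - Pi.single (1, 1) 1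
          - Pi.single (0, 0) 1 : Fin 2 × Fin 2 → ℝ) z * e z ω := by
    filter_upwards [hresp] with ω ⟨h1, h2, h3⟩
    rw [indicator_apply]
    refine (ite_complier_eq (t := fun z => T z ω) h1 h2 h3).2.2.trans ?_
    simp [he_def, Fintype.sum_prod_type, Pi.single_apply]
    ring
  have hg0011 := hprr (hgroup _ _ _ _ _ _ _ _) hi0011
  have hg0101 := hprr (hgroup _ _ _ _ _ _ _ _) hi0101
  have hg0111 := hprr (hgroup _ _ _ _ _ _ _ _) hi0111
  have hx0011 := hint (hgroup _ _ _ _ _ _ _ _) hi0011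
  have hx0101 := hint (hgroup _ _ _ _ _ _ _ _) hi0101
  have hx0111 := hint (hgroup _ _ _ _ _ _ _ _) hi0111
  simp only [Fintype.sum_prod_type, Fin.sum_univ_two, Pi.add_apply, Pi.sub_apply,
    Pi.single_apply, Prod.mk.injEq, zero_ne_one, one_ne_zero, and_true, and_false,
    if_true, if_false] at hg0011 hg0101 hg0111 hx0011 hx0101 hx0111
  have hpos : ∀ C, 0 ≤ prr P C := fun C => ENNReal.toReal_nonneg
  have hall0 : prr P {ω | ∀ z, dflt (T z ω) = 0} = prr P {ω | dflt (T (1, 1) ω) = 0} := by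
    refine congrArg ENNReal.toReal (measure_congr ?_)
    filter_upwards [hresp] with ω ⟨h1, h2, h3⟩
    refine propext ⟨fun h => h (1, 1), fun h => ?_⟩
    have h11 : T (1, 1) ω = 0 := dflt_eq_zero.mp h
    obtain ⟨h10, h01⟩ := h1.mp h11
    change ∀ z, dflt (T z ω) = 0
    simp [Prod.forall, Fin.forall_fin_two, dflt_eq_zero, h11, h10, h01, h2 h10]
  have hall1 : prr P {ω | ∀ z, dflt (T z ω) = 1} = prr P {ω | dflt (T (0, 0) ω) = 1} := by
    refine congrArg ENNReal.toReal (measure_congr ?_)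
    filter_upwards [hresp] with ω ⟨h1, h2, h3⟩
    refine propext ⟨fun h => h (0, 0), fun h => ?_⟩
    have h00 : T (0, 0) ω ≠ 0 := dflt_eq_one.mp h
    have h10 := mt h2 h00
    change ∀ z, dflt (T z ω) = 1
    simp [Prod.forall, Fin.forall_fin_two, dflt_eq_one, h00, h10, mt h3 h00, h1]
  have n0011 := hpos {ω | dflt (T (0, 0) ω) = 0 ∧ dflt (T (1, 0) ω) = 0
    ∧ dflt (T (0, 1) ω) = 1 ∧ dflt (T (1, 1) ω) = 1}
  have n0101 := hpos {ω | dflt (T (0, 0) ω) = 0 ∧ dflt (T (0, 1) ω) = 0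
    ∧ dflt (T (1, 0) ω) = 1 ∧ dflt (T (1, 1) ω) = 1}
  have n0111 := hpos {ω | dflt (T (0, 0) ω) = 0 ∧ dflt (T (1, 0) ω) = 1
    ∧ dflt (T (0, 1) ω) = 1 ∧ dflt (T (1, 1) ω) = 1}
  rw [hg0011] at n0011
  rw [hg0101] at n0101
  rw [hg0111] at n0111
  simp only [cexp, hps, hall0, hall1, hY, hp0, hp1, hg0011, hg0101, hg0111, hx0011, hx0101,
    hx0111]
  refine ⟨trivial, trivial, ?_, ?_, ?_, ?_, ?_, ?_, ?_, ?_, ?_⟩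
  iterate 3 ring
  iterate 3 linarith
  iterate 3 congr 1 <;> ring
end
end
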